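/- The distribution of the coefficients of BDes_n^{D,+}(t) is asymptotically normal as n → ∞, and likewise for BDes_n^{D,-}(t). Moreover, for n ≥ 3 the mean of the coefficient distribution of BDes_n^{D,±}(t) equals n/2, and for n ≥ 4 its variance equals (n+1)/12. -/

import Mathlib

open scoped BigOperators


/-- A model of the hyperoctahedral group `B_n`: a signed permutation is a permutation of
`{1,...,n}` together with a sign for each position; `π_i = ±σ(i)`. -/
abbrev BG (n : ℕ) := Equiv.Perm (Fin n) × (Fin n → Bool)

/-- The value `π_{i+1} ∈ {−n,...,−1,1,...,n}` of a signed permutation at (0-indexed) position `i`. -/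
def bval {n : ℕ} (π : BG n) (i : Fin n) : ℤ :=
  (if π.2 i then -1 else 1) * ((π.1 i : ℤ) + 1)

/-- The value `π_i` at 1-indexed position `i ∈ {1,...,n}`, with the convention `π_0 = 0`. -/
def bvalExt {n : ℕ} (π : BG n) (i : ℕ) : ℤ :=
  if h : 1 ≤ i ∧ i ≤ n then bval π ⟨i - 1, by omega⟩ else 0

/-- `des_B(π) = |{i ∈ {0,...,n−1} : π_i > π_{i+1}}|` with `π_0 = 0`. -/
def desB {n : ℕ} (π : BG n) : ℕ :=
  ((Finset.range n).filter (fun i => bvalExt π (i + 1) < bvalExt π i)).card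

/-- `asc_B(π) = n − des_B(π)`. -/
def ascB {n : ℕ} (π : BG n) : ℕ := n - desB π

/-- `negs(π) = |{i ∈ [n] : π_i < 0}|`. -/
def negs {n : ℕ} (π : BG n) : ℕ :=
  (Finset.univ.filter (fun i : Fin n => bval π i < 0)).card

/-- `inv_A(π) = |{1 ≤ i < j ≤ n : π_i > π_j}|` (usual order on `ℤ`). -/
def invAB {n : ℕ} (π : BG n) : ℕ :=
  (Finset.univ.filter (fun p : Fin n × Fin n => p.1 < p.2 ∧ bval π p.2 < bval π p.1)).card

/-- `inv_D(π) = inv_A(π) + |{1 ≤ i < j ≤ n : −π_i > π_j}|`. -/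
def invDB {n : ℕ} (π : BG n) : ℕ :=
  invAB π +
    (Finset.univ.filter (fun p : Fin n × Fin n => p.1 < p.2 ∧ bval π p.2 < -bval π p.1)).card

/-- `inv_B(π) = inv_A(π) + |{1 ≤ i < j ≤ n : −π_i > π_j}| + negs(π)`. -/
def invBB {n : ℕ} (π : BG n) : ℕ := invDB π + negs π

/-- `exc_B(π) = |{i ∈ [n] : π_{|π_i|} > π_i}| + |{i ∈ [n] : π_i = −i}|`. -/
def excB {n : ℕ} (π : BG n) : ℕ :=
  (Finset.univ.filter (fun i : Fin n => bval π i < bvalExt π (bval π i).natAbs)).card +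
    (Finset.univ.filter (fun i : Fin n => bval π i = -((i : ℤ) + 1))).card

/-- The cumulative distribution function of the standard normal distribution. -/
noncomputable def stdNormalCDF (x : ℝ) : ℝ :=
  ∫ t in Set.Iic x, Real.exp (-t ^ 2 / 2) / Real.sqrt (2 * Real.pi)

/-- Row sum `Sum_n = Σ_k s_{n,k}` of a triangular array of counts. -/
noncomputable def rowSum (c : ℕ → ℕ → ℕ) (n : ℕ) : ℝ := ∑' k : ℕ, (c n k : ℝ)

/-- Mean `Σ_k k·s_{n,k}/Sum_n` of row `n`. -/
noncomputable def rowMean (c : ℕ → ℕ → ℕ) (n : ℕ) : ℝ :=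
  (∑' k : ℕ, (k : ℝ) * (c n k : ℝ)) / rowSum c n

/-- Variance `Σ_k k²·s_{n,k}/Sum_n − (mean)²` of row `n`. -/
noncomputable def rowVar (c : ℕ → ℕ → ℕ) (n : ℕ) : ℝ :=
  (∑' k : ℕ, (k : ℝ) ^ 2 * (c n k : ℝ)) / rowSum c n - rowMean c n ^ 2

/-- `Σ_{k ≤ ⌊y⌋} s_{n,k} / Sum_n` (for `k : ℕ`, `k ≤ ⌊y⌋ ↔ (k:ℝ) ≤ y`). -/
noncomputable def rowCDF (c : ℕ → ℕ → ℕ) (n : ℕ) (y : ℝ) : ℝ :=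
  (∑' k : ℕ, if (k : ℝ) ≤ y then (c n k : ℝ) else 0) / rowSum c n

/-- The triangular array `c` is asymptotically normal:
`lim_n sup_x |Σ_{k ≤ ⌊xσ_n + μ_n⌋} s_{n,k}/Sum_n − Φ(x)| = 0`, where `μ_n`, `σ_n²` are
the mean and variance of row `n`. -/
def IsAsympNormal (c : ℕ → ℕ → ℕ) : Prop :=
  Filter.Tendsto
    (fun n => ⨆ x : ℝ,
      |rowCDF c n (x * Real.sqrt (rowVar c n) + rowMean c n) - stdNormalCDF x|)
    Filter.atTop (nhds 0)

/-- Number of `π ∈ D_n^+` with `des_B(π) = k`. -/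
def cBDesDP (n k : ℕ) : ℕ :=
  (Finset.univ.filter
    (fun π : BG n => Even (negs π) ∧ Even (invDB π) ∧ desB π = k)).card

/-- Number of `π ∈ D_n^-` with `des_B(π) = k`. -/
def cBDesDM (n k : ℕ) : ℕ :=
  (Finset.univ.filter
    (fun π : BG n => Even (negs π) ∧ ¬ Even (invDB π) ∧ desB π = k)).card

section SignedPermutations

open Finset

variable {n : ℕ}

/-- The indicator of a type-`B` descent at position `i`. -/
noncomputable def desInd (π : BG n) (i : ℕ) : ℝ :=
  if bvalExt π (i + 1) < bvalExt π i then 1 else 0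

lemma desB_eq_sum (π : BG n) : (desB π : ℝ) = ∑ i ∈ range n, desInd π i := by
  simp [desB, desInd, Finset.sum_boole]

/-- The linear character `(-1)^negs` of `B_n`. -/
def negsChar (π : BG n) : ℤˣ := ∏ i, if π.2 i then -1 else 1

/-- The linear character `(-1)^inv_D` of `B_n`: the sign of the underlying permutation. -/
def invChar (π : BG n) : ℤˣ := Equiv.Perm.sign π.1

lemma bval_neg_iff (π : BG n) (i : Fin n) : bval π i < 0 ↔ π.2 i = true := by
  unfold bval; split_ifs with h <;> simp [h] <;> omega

lemma natAbs_bval (π : BG n) (i : Fin n) : (bval π i).natAbs = (π.1 i : ℕ) + 1 := by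
  unfold bval; split_ifs <;> omega

lemma prod_ite_neg_one {ι : Type*} (s : Finset ι) (P : ι → Prop) [DecidablePred P] :
    ∏ i ∈ s, (if P i then (-1 : ℤˣ) else 1) = (-1) ^ (s.filter P).card := by
  simp [Finset.prod_ite]

lemma negsChar_eq (π : BG n) : negsChar π = (-1) ^ negs π := by
  simp only [negsChar, negs, bval_neg_iff]
  exact prod_ite_neg_one _ _

lemma invChar_eq (π : BG n) : invChar π = (-1) ^ invDB π := by
  have key : ∀ p : Fin n × Fin n, p.1 < p.2 →
      (if π.1 p.1 < π.1 p.2 then (1 : ℤˣ) else -1) =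
        (if bval π p.2 < bval π p.1 then -1 else 1) *
          (if bval π p.2 < -bval π p.1 then -1 else 1) := by
    intro p hp
    have h1 := natAbs_bval π p.1
    have h2 := natAbs_bval π p.2
    have h3 : (π.1 p.1 : ℕ) ≠ π.1 p.2 := by
      intro h; exact hp.ne (π.1.injective (Fin.ext h))
    simp only [Fin.lt_def]
    split_ifs <;> first | rfl | omega
  rw [invDB, invAB, pow_add, invChar, Equiv.Perm.sign_eq_prod_prod_Ioi]
  simp only [← Finset.filter_filter, ← prod_ite_neg_one]
  rw [← Finset.prod_mul_distrib, Finset.prod_sigma']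
  refine Finset.prod_bij (fun x _ => (x.1, x.2)) ?_ ?_ ?_ ?_
  · rintro ⟨a, b⟩; simp
  · rintro ⟨a, b⟩ _ ⟨c, d⟩ _ h; simpa using h
  · rintro ⟨a, b⟩ h; exact ⟨⟨a, b⟩, by simpa using h, rfl⟩
  · rintro ⟨a, b⟩ h; exact key (a, b) (by simpa using h)

lemma even_iff_neg_one_pow (k : ℕ) : Even k ↔ (-1 : ℤˣ) ^ k = 1 := by
  rcases Nat.even_or_odd k with h | h
  · simp [h, h.neg_one_pow]
  · simp [h.neg_one_pow, Nat.not_even_iff_odd.2 h]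

lemma four_mul_sum_filter {R : Type*} [CommRing R] (f : BG n → R) (s : ℤˣ) :
    4 * ∑ π with negsChar π = 1 ∧ invChar π = s, f π =
      ∑ π, f π + ∑ π, ((negsChar π : ℤ) : R) * f π
        + ((s : ℤ) : R) * (∑ π, ((invChar π : ℤ) : R) * f π
        + ∑ π, (((negsChar π * invChar π : ℤˣ) : ℤ) : R) * f π) := by
  rw [Finset.sum_filter, Finset.mul_sum, mul_add, Finset.mul_sum, Finset.mul_sum,
    ← Finset.sum_add_distrib, ← Finset.sum_add_distrib, ← Finset.sum_add_distrib]
  refine Finset.sum_congr rfl fun π _ => ?_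
  rcases Int.units_eq_one_or (negsChar π) with h1 | h1 <;>
  rcases Int.units_eq_one_or (invChar π) with h2 | h2 <;>
  rcases Int.units_eq_one_or s with h3 | h3 <;>
  simp [h1, h2, h3, ← sub_eq_add_neg] <;> ring

/-- Right multiplication by the signed permutation with underlying permutation `τ` and signs `δ`. -/
def rightMul (τ : Equiv.Perm (Fin n)) (δ : Fin n → Bool) : BG n ≃ BG n where
  toFun π := (π.1 * τ, fun i => xor (π.2 (τ i)) (δ i))
  invFun π := (π.1 * τ⁻¹, fun i => xor (π.2 (τ⁻¹ i)) (δ (τ⁻¹ i)))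
  left_inv π := by ext <;> simp
  right_inv π := by ext <;> simp

lemma bval_rightMul (τ : Equiv.Perm (Fin n)) (δ : Fin n → Bool) (π : BG n) (i : Fin n) :
    bval (rightMul τ δ π) i = (if δ i then -1 else 1) * bval π (τ i) := by
  simp only [bval, rightMul, Equiv.coe_fn_mk, Equiv.Perm.coe_mul, Function.comp_apply]
  rcases Bool.eq_false_or_eq_true (π.2 (τ i)) with h | h <;>
  rcases Bool.eq_false_or_eq_true (δ i) with h' | h' <;> simp [h, h']

lemma invChar_rightMul (τ : Equiv.Perm (Fin n)) (δ : Fin n → Bool) (π : BG n) :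
    invChar (rightMul τ δ π) = invChar π * Equiv.Perm.sign τ := by
  simp [invChar, rightMul]

lemma negsChar_rightMul (τ : Equiv.Perm (Fin n)) (δ : Fin n → Bool) (π : BG n) :
    negsChar (rightMul τ δ π) = negsChar π * ∏ i, if δ i then -1 else 1 := by
  rw [negsChar, negsChar, ← Equiv.prod_comp τ (fun i => if π.2 i then (-1 : ℤˣ) else 1),
    ← Finset.prod_mul_distrib]
  refine Finset.prod_congr rfl fun i _ => ?_
  simp only [rightMul, Equiv.coe_fn_mk]
  rcases Bool.eq_false_or_eq_true (π.2 (τ i)) with h | h <;>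
  rcases Bool.eq_false_or_eq_true (δ i) with h' | h' <;> simp [h, h']

lemma bvalExt_zero (π : BG n) : bvalExt π 0 = 0 := by simp [bvalExt]

lemma bvalExt_succ (π : BG n) (i : Fin n) : bvalExt π (i + 1) = bval π i := by
  simp [bvalExt]

lemma bvalExt_natAbs_injOn (π : BG n) {i j : ℕ} (hi : i ≤ n) (hj : j ≤ n)
    (h : (bvalExt π i).natAbs = (bvalExt π j).natAbs) : i = j := by
  rcases i with _ | i <;> rcases j with _ | j
  · rfl
  · rw [bvalExt_zero, bvalExt_succ π ⟨j, hj⟩, natAbs_bval] at h; simp at h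
  · rw [bvalExt_zero, bvalExt_succ π ⟨i, hi⟩, natAbs_bval] at h; simp at h
  · rw [bvalExt_succ π ⟨i, hi⟩, bvalExt_succ π ⟨j, hj⟩, natAbs_bval, natAbs_bval] at h
    have := π.1.injective (Fin.ext (Nat.succ.inj h))
    simpa using this

/-- Change the sign of the entry in position `p + 1`. -/
def flipAt (p : Fin n) : BG n ≃ BG n := rightMul 1 (fun i => decide (i = p))

/-- Exchange the entries in positions `p + 1` and `q + 1`. -/
def swapAt (p q : Fin n) : BG n ≃ BG n := rightMul (Equiv.swap p q) (fun _ => false)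

lemma bvalExt_flipAt (p : Fin n) (π : BG n) (k : ℕ) :
    bvalExt (flipAt p π) k = if k = p + 1 then -bvalExt π (p + 1) else bvalExt π k := by
  by_cases h : 1 ≤ k ∧ k ≤ n
  · obtain ⟨i, rfl⟩ : ∃ i : Fin n, k = i + 1 := ⟨⟨k - 1, by omega⟩, by simp; omega⟩
    simp only [bvalExt_succ, flipAt, bval_rightMul, decide_eq_true_eq, add_left_inj, Fin.val_inj]
    split_ifs with h <;> simp [h]
  · have : k ≠ p + 1 := by omega
    simp [bvalExt, h, this]

lemma bvalExt_swapAt (p q : Fin n) (π : BG n) (k : ℕ) :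
    bvalExt (swapAt p q π) k = if k = p + 1 then bvalExt π (q + 1) else
      if k = q + 1 then bvalExt π (p + 1) else bvalExt π k := by
  by_cases h : 1 ≤ k ∧ k ≤ n
  · obtain ⟨i, rfl⟩ : ∃ i : Fin n, k = i + 1 := ⟨⟨k - 1, by omega⟩, by simp; omega⟩
    simp only [bvalExt_succ, swapAt, bval_rightMul, add_left_inj, Fin.val_inj,
      Equiv.swap_apply_def, Bool.false_eq_true, if_false, one_mul]
    split_ifs <;> rfl
  · have : k ≠ p + 1 := by omega
    have : k ≠ q + 1 := by omega
    simp [bvalExt, *]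

lemma negsChar_flipAt (p : Fin n) (π : BG n) : negsChar (flipAt p π) = -negsChar π := by
  simp [flipAt, negsChar_rightMul]

lemma invChar_flipAt (p : Fin n) (π : BG n) : invChar (flipAt p π) = invChar π := by
  simp [flipAt, invChar_rightMul]

lemma negsChar_swapAt (p q : Fin n) (π : BG n) : negsChar (swapAt p q π) = negsChar π := by
  simp [swapAt, negsChar_rightMul]

lemma invChar_swapAt {p q : Fin n} (h : p ≠ q) (π : BG n) :
    invChar (swapAt p q π) = -invChar π := by
  simp [swapAt, invChar_rightMul, Equiv.Perm.sign_swap h]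

/-- Exchange the entries in positions `p + 1` and `q + 1` and change both signs. -/
def negSwapAt (p q : Fin n) : BG n ≃ BG n := (swapAt p q).trans ((flipAt p).trans (flipAt q))

lemma bvalExt_negSwapAt {p q : Fin n} (h : p ≠ q) (π : BG n) (k : ℕ) :
    bvalExt (negSwapAt p q π) k = if k = p + 1 then -bvalExt π (q + 1) else
      if k = q + 1 then -bvalExt π (p + 1) else bvalExt π k := by
  have h' : (p : ℕ) ≠ q := fun e => h (Fin.ext e)
  simp only [negSwapAt, Equiv.trans_apply, bvalExt_flipAt, bvalExt_swapAt]
  split_ifs <;> first | rfl | omega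

lemma negsChar_negSwapAt (p q : Fin n) (π : BG n) : negsChar (negSwapAt p q π) = negsChar π := by
  simp [negSwapAt, negsChar_flipAt, negsChar_swapAt]

lemma invChar_negSwapAt {p q : Fin n} (h : p ≠ q) (π : BG n) :
    invChar (negSwapAt p q π) = -invChar π := by
  simp [negSwapAt, invChar_flipAt, invChar_swapAt h]

lemma desInd_congr {π π' : BG n} {i j : ℕ}
    (h : bvalExt π (i + 1) < bvalExt π i ↔ bvalExt π' (j + 1) < bvalExt π' j) :
    desInd π i = desInd π' j := by
  simp [desInd, h]

lemma desInd_compl {π π' : BG n} {i j : ℕ}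
    (h : bvalExt π (i + 1) < bvalExt π i ↔ ¬ bvalExt π' (j + 1) < bvalExt π' j) :
    desInd π i = 1 - desInd π' j := by
  simp only [desInd, h]; split_ifs <;> norm_num

lemma desInd_flipAt_of_ne {p : Fin n} {i : ℕ} (h : i ≠ p) (h' : i ≠ p + 1) (π : BG n) :
    desInd (flipAt p π) i = desInd π i := by
  apply desInd_congr
  simp [bvalExt_flipAt, h, h']

lemma desInd_swapAt_of_ne {p q : Fin n} {i : ℕ} (h : i ≠ p) (h' : i ≠ p + 1) (hq : i ≠ q)
    (hq' : i ≠ q + 1) (π : BG n) : desInd (swapAt p q π) i = desInd π i := by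
  apply desInd_congr
  simp [bvalExt_swapAt, h, h', hq, hq']

lemma desInd_negSwapAt_of_ne {p q : Fin n} {i : ℕ} (hpq : p ≠ q) (h : i ≠ p) (h' : i ≠ p + 1)
    (hq : i ≠ q) (hq' : i ≠ q + 1) (π : BG n) : desInd (negSwapAt p q π) i = desInd π i := by
  apply desInd_congr
  simp [bvalExt_negSwapAt hpq, h, h', hq, hq']

lemma desInd_negSwapAt_succ {k : ℕ} (h : k + 1 < n) (π : BG n) :
    desInd (negSwapAt ⟨k, by omega⟩ ⟨k + 1, h⟩ π) (k + 1) = desInd π (k + 1) := by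
  apply desInd_congr
  rw [bvalExt_negSwapAt (by simp), bvalExt_negSwapAt (by simp)]
  simp

lemma desInd_swapAt_succ {k : ℕ} (h : k + 1 < n) (π : BG n) :
    desInd (swapAt ⟨k, by omega⟩ ⟨k + 1, h⟩ π) (k + 1) = 1 - desInd π (k + 1) := by
  apply desInd_compl
  have := mt (bvalExt_natAbs_injOn π (i := k + 1) (j := k + 2) (by omega) (by omega)) (by omega)
  simp only [bvalExt_swapAt]
  simp
  grind

lemma desInd_flipAt_zero (h : 0 < n) (π : BG n) :
    desInd (flipAt ⟨0, h⟩ π) 0 = 1 - desInd π 0 := by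
  apply desInd_compl
  have := mt (bvalExt_natAbs_injOn π (i := 0) (j := 1) (by omega) (by omega)) (by omega)
  rw [bvalExt_zero] at this
  simp only [bvalExt_flipAt]
  simp [bvalExt_zero]
  omega

lemma charSum_eq_zero {χ : BG n → ℤˣ} {F : BG n → ℝ} (e : BG n ≃ BG n)
    (hχ : ∀ π, χ (e π) = -χ π) (hF : ∀ π, F (e π) = F π) :
    ∑ π, ((χ π : ℤ) : ℝ) * F π = 0 := by
  have := Equiv.sum_comp e (fun π => ((χ π : ℤ) : ℝ) * F π)
  simp only [hχ, hF, Units.val_neg, Int.cast_neg, neg_mul, Finset.sum_neg_distrib] at this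
  linarith

/-- All three nontrivial linear characters of `B_n` are orthogonal to `F`. -/
def CharOrthogonal (F : BG n → ℝ) : Prop :=
  ∑ π, ((negsChar π : ℤ) : ℝ) * F π = 0 ∧ ∑ π, ((invChar π : ℤ) : ℝ) * F π = 0 ∧
    ∑ π, (((negsChar π * invChar π : ℤˣ) : ℤ) : ℝ) * F π = 0

lemma CharOrthogonal.sum {ι : Type*} {s : Finset ι} {F : ι → BG n → ℝ}
    (h : ∀ i ∈ s, CharOrthogonal (F i)) : CharOrthogonal (fun π => ∑ i ∈ s, F i π) := by
  refine ⟨?_, ?_, ?_⟩ <;> simp only [Finset.mul_sum] <;> rw [Finset.sum_comm] <;>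
    refine Finset.sum_eq_zero fun i hi => ?_
  exacts [(h i hi).1, (h i hi).2.1, (h i hi).2.2]

lemma CharOrthogonal.of_flipAt {F : BG n → ℝ} (p : Fin n) (hp : ∀ π, F (flipAt p π) = F π)
    (h : ∑ π, ((invChar π : ℤ) : ℝ) * F π = 0) : CharOrthogonal F :=
  ⟨charSum_eq_zero (flipAt p) (negsChar_flipAt p) hp, h,
    charSum_eq_zero (flipAt p) (by simp [negsChar_flipAt, invChar_flipAt]) hp⟩

lemma CharOrthogonal.of_negSwapAt {F : BG n → ℝ} {p q : Fin n} (hpq : p ≠ q)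
    (hp : ∀ π, F (negSwapAt p q π) = F π)
    (h : ∑ π, ((negsChar π : ℤ) : ℝ) * F π = 0) : CharOrthogonal F :=
  ⟨h, charSum_eq_zero (negSwapAt p q) (invChar_negSwapAt hpq) hp,
    charSum_eq_zero (negSwapAt p q) (by simp [negsChar_negSwapAt, invChar_negSwapAt hpq]) hp⟩

lemma charOrthogonal_one (hn : 2 ≤ n) : CharOrthogonal (fun _ : BG n => 1) :=
  .of_negSwapAt (p := ⟨0, by omega⟩) (q := ⟨1, by omega⟩) (by simp) (fun _ => rfl)
    (charSum_eq_zero (flipAt ⟨0, by omega⟩) (negsChar_flipAt _) (fun _ => rfl))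

lemma charOrthogonal_desInd (hn : 3 ≤ n) {i : ℕ} (hi : i < n) :
    CharOrthogonal (fun π : BG n => desInd π i) := by
  have h : ∑ π : BG n, ((negsChar π : ℤ) : ℝ) * desInd π i = 0 := by
    by_cases h : i ≤ 1
    · exact charSum_eq_zero (flipAt ⟨2, by omega⟩) (negsChar_flipAt _)
        (desInd_flipAt_of_ne (by simp; omega) (by simp; omega))
    · exact charSum_eq_zero (flipAt ⟨0, by omega⟩) (negsChar_flipAt _)
        (desInd_flipAt_of_ne (by simp; omega) (by simp; omega))
  rcases i with _ | k
  · exact .of_negSwapAt (p := ⟨1, by omega⟩) (q := ⟨2, by omega⟩) (by simp)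
      (desInd_negSwapAt_of_ne (by simp) (by simp) (by simp) (by simp) (by simp)) h
  · exact .of_negSwapAt (p := ⟨k, by omega⟩) (q := ⟨k + 1, by omega⟩) (by simp)
      (desInd_negSwapAt_succ hi) h

lemma charOrthogonal_desInd_mul_of_add_two_le {i j : ℕ} (hij : i + 2 ≤ j) (hj : j < n) :
    CharOrthogonal (fun π : BG n => desInd π i * desInd π j) := by
  obtain ⟨k, rfl⟩ : ∃ k, j = k + 1 := ⟨j - 1, by omega⟩
  refine .of_negSwapAt (p := ⟨k, by omega⟩) (q := ⟨k + 1, by omega⟩) (by simp) (fun π => ?_) ?_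
  · rw [desInd_negSwapAt_succ hj, desInd_negSwapAt_of_ne] <;> simp <;> omega
  have h0 : ∑ π : BG n, ((negsChar π : ℤ) : ℝ) * desInd π i = 0 :=
    charSum_eq_zero (flipAt ⟨k, by omega⟩) (negsChar_flipAt _)
      (desInd_flipAt_of_ne (by simp; omega) (by simp; omega))
  have h1 := Equiv.sum_comp (flipAt ⟨k, by omega⟩)
    (fun π : BG n => ((negsChar π : ℤ) : ℝ) * (desInd π i * desInd π (k + 1)))
  have h2 := Equiv.sum_comp (flipAt ⟨k + 1, by omega⟩)
    (fun π : BG n => ((negsChar π : ℤ) : ℝ) * (desInd π i * desInd π (k + 1)))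
  have h3 : ∀ π : BG n, desInd (flipAt ⟨k, by omega⟩ π) (k + 1) =
      1 - desInd (flipAt ⟨k + 1, by omega⟩ π) (k + 1) := by
    intro π
    apply desInd_compl
    have := mt (bvalExt_natAbs_injOn π (i := k + 1) (j := k + 2) (by omega) (by omega)) (by omega)
    simp only [bvalExt_flipAt]
    simp
    grind
  simp (disch := simp; omega) only [negsChar_flipAt, h3, desInd_flipAt_of_ne (i := i)] at h1 h2
  simp only [Units.val_neg, Int.cast_neg, neg_mul, mul_sub, mul_one, Finset.sum_neg_distrib,
    Finset.sum_sub_distrib] at h1 h2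
  linarith

lemma charOrthogonal_desInd_mul_succ (hn : 4 ≤ n) {i : ℕ} (hi : i + 1 < n) :
    CharOrthogonal (fun π : BG n => desInd π i * desInd π (i + 1)) := by
  rcases i with _ | k
  · refine .of_negSwapAt (p := ⟨2, by omega⟩) (q := ⟨3, by omega⟩) (by simp) (fun π => ?_)
      (charSum_eq_zero (flipAt ⟨2, by omega⟩) (negsChar_flipAt _) fun π => ?_)
    · rw [desInd_negSwapAt_of_ne, desInd_negSwapAt_of_ne] <;> simp
    · rw [desInd_flipAt_of_ne, desInd_flipAt_of_ne] <;> simp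
  · have h : ∑ π : BG n, ((invChar π : ℤ) : ℝ) * (desInd π (k + 1) * desInd π (k + 1 + 1)) = 0 := by
      have hne : (⟨k, by omega⟩ : Fin n) ≠ ⟨k + 2, by omega⟩ := by simp
      refine charSum_eq_zero
        ((negSwapAt ⟨k, by omega⟩ ⟨k + 2, by omega⟩).trans (flipAt ⟨k + 1, by omega⟩)) ?_ ?_
      · simp [invChar_flipAt, invChar_negSwapAt hne]
      · intro π
        rw [mul_comm]
        congr 1 <;> apply desInd_congr <;>
          simp [bvalExt_flipAt, bvalExt_negSwapAt hne, show k + 1 + 1 ≠ k by omega]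
    by_cases hk : k = 0
    · subst hk
      refine .of_flipAt ⟨3, by omega⟩ (fun π => ?_) h
      rw [desInd_flipAt_of_ne, desInd_flipAt_of_ne] <;> simp
    · refine .of_flipAt ⟨0, by omega⟩ (fun π => ?_) h
      rw [desInd_flipAt_of_ne, desInd_flipAt_of_ne] <;> simp; omega

lemma two_mul_sum_mul {F G : BG n → ℝ} (e : BG n ≃ BG n) (hF : ∀ π, F (e π) = F π)
    (hG : ∀ π, G (e π) = 1 - G π) : 2 * ∑ π, F π * G π = ∑ π, F π := by
  have := Equiv.sum_comp e (fun π => F π * G π)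
  simp only [hF, hG, mul_sub, mul_one, Finset.sum_sub_distrib] at this
  linarith

lemma sum_desInd {i : ℕ} (hi : i < n) :
    ∑ π : BG n, desInd π i = (Fintype.card (BG n) : ℝ) / 2 := by
  have : 2 * ∑ π : BG n, 1 * desInd π i = ∑ _π : BG n, 1 := by
    rcases i with _ | k
    · exact two_mul_sum_mul (flipAt ⟨0, hi⟩) (fun _ => rfl) (desInd_flipAt_zero hi)
    · exact two_mul_sum_mul (swapAt ⟨k, by omega⟩ ⟨k + 1, hi⟩) (fun _ => rfl)
        (desInd_swapAt_succ hi)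
  simp only [one_mul, Finset.sum_const, Finset.card_univ, nsmul_eq_mul, mul_one] at this
  linarith

lemma sum_desInd_mul_of_add_two_le {i j : ℕ} (hij : i + 2 ≤ j) (hj : j < n) :
    ∑ π : BG n, desInd π i * desInd π j = (Fintype.card (BG n) : ℝ) / 4 := by
  obtain ⟨k, rfl⟩ : ∃ k, j = k + 1 := ⟨j - 1, by omega⟩
  have := two_mul_sum_mul (F := fun π => desInd π i) (G := fun π => desInd π (k + 1))
    (swapAt ⟨k, by omega⟩ ⟨k + 1, hj⟩)
    (desInd_swapAt_of_ne (by simp; omega) (by simp; omega) (by simp; omega) (by simp; omega))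
    (desInd_swapAt_succ hj)
  rw [sum_desInd (by omega)] at this
  linarith

lemma sum_desInd_zero_mul_one (hn : 1 < n) :
    ∑ π : BG n, desInd π 0 * desInd π 1 = (Fintype.card (BG n) : ℝ) / 8 := by
  set q : BG n → ℝ := fun π => if bvalExt π 2 < 0 then 1 else 0 with hq
  have h1 : 2 * ∑ π, desInd π 0 * q π = ∑ π : BG n, desInd π 0 := by
    refine two_mul_sum_mul (flipAt ⟨1, hn⟩)
      (desInd_flipAt_of_ne (by simp) (by simp)) (fun π => ?_)
    have := mt (bvalExt_natAbs_injOn π (i := 0) (j := 2) (by omega) (by omega)) (by omega)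
    rw [bvalExt_zero] at this
    simp only [hq, bvalExt_flipAt]
    simp
    grind
  have h2 : ∑ π : BG n, q π * (1 - desInd π 1) = ∑ π : BG n, desInd π 0 * desInd π 1 := by
    rw [← Equiv.sum_comp (swapAt ⟨0, by omega⟩ ⟨1, hn⟩)]
    refine Finset.sum_congr rfl fun π _ => ?_
    rw [desInd_swapAt_succ (k := 0) hn]
    simp [hq, bvalExt_swapAt, desInd, bvalExt_zero]
  have h3 : ∀ π : BG n, desInd π 0 * desInd π 1 + q π * (1 - desInd π 1) = desInd π 0 * q π := by
    intro π
    simp only [hq, desInd, bvalExt_zero]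
    split_ifs <;> norm_num <;> simp at * <;> omega
  have h4 := Finset.sum_congr rfl fun π (_ : π ∈ Finset.univ) => h3 π
  rw [Finset.sum_add_distrib, h2] at h4
  rw [sum_desInd (by omega)] at h1
  linarith

lemma sum_desInd_mul_succ {k : ℕ} (hk : k + 2 < n) :
    ∑ π : BG n, desInd π (k + 1) * desInd π (k + 2) = (Fintype.card (BG n) : ℝ) / 6 := by
  set r : BG n → ℝ := fun π => if bvalExt π (k + 1) < bvalExt π (k + 3) then 1 else 0 with hr
  set e : BG n ≃ BG n := (swapAt ⟨k, by omega⟩ ⟨k + 1, by omega⟩).trans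
    (swapAt ⟨k + 1, by omega⟩ ⟨k + 2, by omega⟩) with he
  have e1 : ∀ π, desInd (e π) (k + 1) = desInd π (k + 2) := fun π => by
    simp [he, desInd, bvalExt_swapAt]
  have e2 : ∀ π, desInd (e π) (k + 2) = r π := fun π => by
    simp [he, desInd, bvalExt_swapAt, hr]
  have e3 : ∀ π, r (e π) = desInd π (k + 1) := fun π => by
    simp [he, desInd, bvalExt_swapAt, hr]
  have h1 := Equiv.sum_comp e (fun π => desInd π (k + 1) * desInd π (k + 2))
  have h2 := Equiv.sum_comp e (fun π => desInd π (k + 2) * r π)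
  have h3 := Equiv.sum_comp e r
  simp only [e1, e2, e3] at h1 h2 h3
  have h4 : ∀ π : BG n, desInd π (k + 1) * desInd π (k + 2) + desInd π (k + 2) * r π
      + r π * desInd π (k + 1) = desInd π (k + 1) + desInd π (k + 2) + r π - 1 := by
    intro π
    have i1 := mt (bvalExt_natAbs_injOn π (i := k + 1) (j := k + 2) (by omega) (by omega))
      (by omega)
    have i2 := mt (bvalExt_natAbs_injOn π (i := k + 1) (j := k + 3) (by omega) (by omega))
      (by omega)
    have i3 := mt (bvalExt_natAbs_injOn π (i := k + 2) (j := k + 3) (by omega) (by omega))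
      (by omega)
    simp only [hr, desInd, add_assoc, Nat.reduceAdd]
    split_ifs <;> norm_num <;> omega
  have h5 := Finset.sum_congr rfl fun π (_ : π ∈ Finset.univ) => h4 π
  simp only [Finset.sum_add_distrib, Finset.sum_sub_distrib, ← h3, Finset.sum_const,
    Finset.card_univ, nsmul_eq_mul, mul_one, sum_desInd (show k + 1 < n by omega),
    sum_desInd hk] at h5
  linarith

/-- The second moments `E[d_i d_j]` of descent indicators. -/
noncomputable def desMoment (i j : ℕ) : ℝ :=
  if i = j then 1 / 2 else if i + 1 = j then (if i = 0 then 1 / 8 else 1 / 6) else 1 / 4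

lemma sum_desInd_mul_of_le {i j : ℕ} (hij : i ≤ j) (hj : j < n) :
    ∑ π : BG n, desInd π i * desInd π j = desMoment i j * Fintype.card (BG n) := by
  rcases hij.eq_or_lt with rfl | h
  · have : ∀ π : BG n, desInd π i * desInd π i = desInd π i := fun π => by simp [desInd]
    simp only [this, sum_desInd hj, desMoment, if_true]; ring
  rcases Nat.lt_or_ge (i + 1) j with h' | h'
  · rw [sum_desInd_mul_of_add_two_le h' hj, desMoment, if_neg h.ne, if_neg h'.ne]; ring
  obtain rfl : j = i + 1 := by omega
  rcases i with _ | k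
  · rw [sum_desInd_zero_mul_one hj]; simp [desMoment]; ring
  · rw [sum_desInd_mul_succ hj]; simp [desMoment]; ring

lemma charOrthogonal_desInd_mul_of_le (hn : 4 ≤ n) {i j : ℕ} (hij : i ≤ j) (hj : j < n) :
    CharOrthogonal (fun π : BG n => desInd π i * desInd π j) := by
  rcases hij.eq_or_lt with rfl | h
  · have : ∀ π : BG n, desInd π i * desInd π i = desInd π i := fun π => by simp [desInd]
    simp only [this]
    exact charOrthogonal_desInd (by omega) hj
  rcases Nat.lt_or_ge (i + 1) j with h' | h'
  · exact charOrthogonal_desInd_mul_of_add_two_le h' hj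
  obtain rfl : j = i + 1 := by omega
  exact charOrthogonal_desInd_mul_succ hn hj

lemma sum_desMoment_lt {j : ℕ} (hj : 2 ≤ j) :
    ∑ i ∈ range j, desMoment i j = (j : ℝ) / 4 - 1 / 12 := by
  obtain ⟨m, rfl⟩ : ∃ m, j = m + 2 := ⟨j - 2, by omega⟩
  rw [Finset.sum_range_succ]
  have : ∀ i ∈ range (m + 1), desMoment i (m + 2) = 1 / 4 := by
    intro i hi
    have := Finset.mem_range.1 hi
    rw [desMoment, if_neg (by omega), if_neg (by omega)]
  rw [Finset.sum_congr rfl this]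
  simp [desMoment]
  ring

lemma sq_sum_range_succ (f : ℕ → ℝ) (m : ℕ) :
    (∑ i ∈ range (m + 1), f i) ^ 2 =
      (∑ i ∈ range m, f i) ^ 2 + 2 * ∑ i ∈ range m, f i * f m + f m * f m := by
  rw [Finset.sum_range_succ, ← Finset.sum_mul]; ring

lemma sum_sq_sum_desInd {m : ℕ} (hm : 2 ≤ m) (hmn : m ≤ n) :
    ∑ π : BG n, (∑ i ∈ range m, desInd π i) ^ 2 =
      ((m : ℝ) ^ 2 / 4 + ((m : ℝ) + 1) / 12) * Fintype.card (BG n) := by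
  induction m, hm using Nat.le_induction with
  | base =>
    simp only [Finset.sum_range_succ, Finset.sum_range_zero, zero_add]
    have : ∀ π : BG n, (desInd π 0 + desInd π 1) ^ 2 = desInd π 0 * desInd π 0
        + 2 * (desInd π 0 * desInd π 1) + desInd π 1 * desInd π 1 := fun π => by ring
    simp only [this, Finset.sum_add_distrib, ← Finset.mul_sum,
      sum_desInd_mul_of_le le_rfl (show 0 < n by omega), sum_desInd_mul_of_le zero_le_one hmn,
      sum_desInd_mul_of_le le_rfl (show 1 < n by omega)]
    simp [desMoment]; ring
  | succ m hm ih =>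
    simp only [sq_sum_range_succ, Finset.sum_add_distrib, ← Finset.mul_sum, ih (by omega)]
    rw [Finset.sum_comm, Finset.sum_congr rfl fun i hi =>
      sum_desInd_mul_of_le (n := n) (Finset.mem_range.1 hi).le hmn, ← Finset.sum_mul,
      sum_desMoment_lt hm, sum_desInd_mul_of_le le_rfl hmn]
    simp [desMoment]; ring

lemma charOrthogonal_sq_sum_desInd (hn : 4 ≤ n) {m : ℕ} (hmn : m ≤ n) :
    CharOrthogonal (fun π : BG n => (∑ i ∈ range m, desInd π i) ^ 2) := by
  have : ∀ π : BG n, (∑ i ∈ range m, desInd π i) ^ 2 =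
      ∑ p ∈ range m ×ˢ range m, desInd π p.1 * desInd π p.2 := fun π => by
    rw [sq, Finset.sum_mul_sum, Finset.sum_product]
  simp only [this]
  refine .sum fun p hp => ?_
  simp only [Finset.mem_product, Finset.mem_range] at hp
  rcases le_total p.1 p.2 with h | h
  · exact charOrthogonal_desInd_mul_of_le hn h (by omega)
  · simp only [mul_comm (desInd _ p.1)]
    exact charOrthogonal_desInd_mul_of_le hn h (by omega)

lemma CharOrthogonal.sum_filter {F : BG n → ℝ} (h : CharOrthogonal F) (s : ℤˣ) :
    ∑ π with negsChar π = 1 ∧ invChar π = s, F π = (∑ π, F π) / 4 := by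
  have := four_mul_sum_filter F s
  rw [h.1, h.2.1, h.2.2] at this
  linarith

lemma sum_filter_one (hn : 2 ≤ n) (s : ℤˣ) :
    ∑ π : BG n with negsChar π = 1 ∧ invChar π = s, (1 : ℝ) = Fintype.card (BG n) / 4 := by
  rw [(charOrthogonal_one hn).sum_filter]; simp

lemma sum_filter_desB (hn : 3 ≤ n) (s : ℤˣ) :
    ∑ π : BG n with negsChar π = 1 ∧ invChar π = s, (desB π : ℝ) =
      n / 2 * (Fintype.card (BG n) / 4) := by
  simp only [desB_eq_sum]
  rw [(CharOrthogonal.sum fun i hi =>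
    charOrthogonal_desInd hn (Finset.mem_range.1 hi)).sum_filter, Finset.sum_comm,
    Finset.sum_congr rfl fun i hi => sum_desInd (Finset.mem_range.1 hi)]
  simp; ring

lemma sum_filter_desB_sq (hn : 4 ≤ n) (s : ℤˣ) :
    ∑ π : BG n with negsChar π = 1 ∧ invChar π = s, (desB π : ℝ) ^ 2 =
      ((n : ℝ) ^ 2 / 4 + ((n : ℝ) + 1) / 12) * (Fintype.card (BG n) / 4) := by
  simp only [desB_eq_sum]
  rw [(charOrthogonal_sq_sum_desInd hn le_rfl).sum_filter, sum_sq_sum_desInd (by omega) le_rfl]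
  ring

end SignedPermutations

section RowStatistics

open Finset

/-- The number of `π ∈ D_n` with `(-1)^inv_D(π) = s` and `des_B(π) = k`. -/
def desCount (s : ℤˣ) (n k : ℕ) : ℕ :=
  #{π : BG n | negsChar π = 1 ∧ invChar π = s ∧ desB π = k}

lemma cBDesDP_eq : cBDesDP = desCount 1 := by
  funext n k
  simp only [cBDesDP, desCount, even_iff_neg_one_pow, ← negsChar_eq, ← invChar_eq]

lemma cBDesDM_eq : cBDesDM = desCount (-1) := by
  funext n k
  simp only [cBDesDM, desCount, even_iff_neg_one_pow, ← negsChar_eq, ← invChar_eq,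
    Int.units_ne_iff_eq_neg]

lemma tsum_mul_desCount (s : ℤˣ) (n : ℕ) (g : ℕ → ℝ) :
    ∑' k, g k * (desCount s n k : ℝ) =
      ∑ π : BG n with negsChar π = 1 ∧ invChar π = s, g (desB π) := by
  have hc : ∀ k, (desCount s n k : ℝ) =
      ∑ π : BG n with negsChar π = 1 ∧ invChar π = s, if desB π = k then 1 else 0 := fun k => by
    simp only [desCount, Finset.sum_boole, Finset.filter_filter, and_assoc]
  have hd : ∀ π : BG n, desB π ∈ range (n + 1) := fun π => by
    rw [Finset.mem_range, Nat.lt_succ_iff]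
    exact (Finset.card_filter_le _ _).trans (by simp)
  simp only [hc]
  rw [tsum_eq_sum (s := range (n + 1))]
  · simp only [Finset.mul_sum]
    rw [Finset.sum_comm]
    refine Finset.sum_congr rfl fun π _ => ?_
    simp [hd π, -Finset.mem_range]
  · intro k hk
    rw [Finset.sum_eq_zero, mul_zero]
    intro π _
    rw [if_neg]
    rintro rfl
    exact hk (hd π)

lemma rowSum_desCount {n : ℕ} (hn : 2 ≤ n) (s : ℤˣ) :
    rowSum (desCount s) n = Fintype.card (BG n) / 4 := by
  rw [rowSum, ← sum_filter_one hn s]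
  simpa using tsum_mul_desCount s n (fun _ => 1)

lemma rowMean_desCount {n : ℕ} (hn : 3 ≤ n) (s : ℤˣ) : rowMean (desCount s) n = (n : ℝ) / 2 := by
  have : (Fintype.card (BG n) : ℝ) ≠ 0 := by exact_mod_cast Fintype.card_ne_zero
  rw [rowMean, rowSum_desCount (by omega), tsum_mul_desCount s n (fun k => (k : ℝ)),
    sum_filter_desB hn]
  field_simp

lemma rowVar_desCount {n : ℕ} (hn : 4 ≤ n) (s : ℤˣ) :
    rowVar (desCount s) n = ((n : ℝ) + 1) / 12 := by
  have : (Fintype.card (BG n) : ℝ) ≠ 0 := by exact_mod_cast Fintype.card_ne_zero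
  rw [rowVar, rowSum_desCount (by omega), rowMean_desCount (by omega),
    tsum_mul_desCount s n (fun k => (k : ℝ) ^ 2), sum_filter_desB_sq hn]
  field_simp
  ring

lemma rowCDF_desCount {n : ℕ} (hn : 2 ≤ n) (s : ℤˣ) (y : ℝ) :
    rowCDF (desCount s) n y =
      (∑ π : BG n with negsChar π = 1 ∧ invChar π = s, if (desB π : ℝ) ≤ y then (1 : ℝ) else 0) /
        (Fintype.card (BG n) / 4) := by
  rw [rowCDF, rowSum_desCount hn, ← tsum_mul_desCount s n (fun k => if (k : ℝ) ≤ y then 1 else 0)]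
  simp only [ite_mul, one_mul, zero_mul]

end RowStatistics

section CharacterSums

open Finset Complex

variable {n : ℕ}

lemma norm_exp_I_mul_sub_le (a b : ℝ) : ‖cexp (I * a) - cexp (I * b)‖ ≤ |a - b| := by
  have h : cexp (I * a) - cexp (I * b) = cexp (I * b) * (cexp (I * (a - b : ℝ)) - 1) := by
    rw [mul_sub, ← Complex.exp_add, mul_one]; congr 2; push_cast; ring
  rw [h, norm_mul, mul_comm I, Complex.norm_exp_ofReal_mul_I, one_mul]
  exact Real.norm_exp_I_mul_ofReal_sub_one_le

lemma abs_desB_sub_le {π π' : BG n} {s : Finset ℕ} (h : ∀ i ∉ s, desInd π i = desInd π' i) :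
    |(desB π : ℝ) - desB π'| ≤ #s := by
  have hle : ∀ i, |desInd π i - desInd π' i| ≤ if i ∈ s then 1 else 0 := fun i => by
    split_ifs with hi
    · unfold desInd; split_ifs <;> norm_num
    · simp [h i hi]
  rw [desB_eq_sum, desB_eq_sum, ← Finset.sum_sub_distrib]
  refine (Finset.abs_sum_le_sum_abs _ _).trans ((Finset.sum_le_sum fun i _ => hle i).trans ?_)
  rw [Finset.sum_boole]
  exact_mod_cast Finset.card_le_card fun i hi => (Finset.mem_filter.1 hi).2

/-- The character `exp(iθ(des_B(π) - n/2))`. -/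
noncomputable def desPhase (θ : ℝ) (π : BG n) : ℂ := cexp (I * (θ * (desB π - n / 2) : ℝ))

lemma norm_charSum_desPhase_le {χ : BG n → ℤˣ} (e : BG n ≃ BG n) {s : Finset ℕ} (hs : #s ≤ 3)
    (hχ : ∀ π, χ (e π) = -χ π) (he : ∀ π, ∀ i ∉ s, desInd (e π) i = desInd π i) (θ : ℝ) :
    ‖∑ π, ((χ π : ℤ) : ℂ) * desPhase θ π‖ ≤ 3 / 2 * |θ| * Fintype.card (BG n) := by
  have h2 : 2 * ∑ π, ((χ π : ℤ) : ℂ) * desPhase θ π =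
      ∑ π, ((χ π : ℤ) : ℂ) * (desPhase θ π - desPhase θ (e π)) := by
    have := Equiv.sum_comp e (fun π => ((χ π : ℤ) : ℂ) * desPhase θ π)
    simp only [hχ, Units.val_neg, Int.cast_neg, neg_mul, Finset.sum_neg_distrib] at this
    simp only [mul_sub, Finset.sum_sub_distrib]
    linear_combination -this
  have h3 : ‖∑ π, ((χ π : ℤ) : ℂ) * (desPhase θ π - desPhase θ (e π))‖ ≤
      ∑ _π : BG n, 3 * |θ| := by
    refine norm_sum_le_of_le _ fun π _ => ?_
    have h1 : ‖((χ π : ℤ) : ℂ)‖ = 1 := by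
      rcases Int.units_eq_one_or (χ π) with h | h <;> simp [h]
    rw [norm_mul, h1, one_mul]
    refine (norm_exp_I_mul_sub_le _ _).trans ?_
    have := (abs_desB_sub_le (he π)).trans (Nat.cast_le.2 hs)
    rw [← mul_sub, abs_mul, mul_comm, sub_sub_sub_cancel_right, abs_sub_comm]
    gcongr
    exact_mod_cast this
  rw [← h2, norm_mul, Complex.norm_two, Finset.sum_const, Finset.card_univ, nsmul_eq_mul] at h3
  linarith

lemma norm_four_mul_sum_filter_desPhase_sub_le (hn : 2 ≤ n) (s : ℤˣ) (θ : ℝ) :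
    ‖4 * ∑ π : BG n with negsChar π = 1 ∧ invChar π = s, desPhase θ π - ∑ π : BG n, desPhase θ π‖
      ≤ 9 / 2 * |θ| * Fintype.card (BG n) := by
  have hflip : ∀ π : BG n, ∀ i ∉ ({0, 1} : Finset ℕ),
      desInd (flipAt ⟨0, by omega⟩ π) i = desInd π i := fun π i hi =>
    desInd_flipAt_of_ne (by simp at hi ⊢; omega) (by simp at hi ⊢; omega) π
  have hswap : ∀ π : BG n, ∀ i ∉ ({0, 1, 2} : Finset ℕ),
      desInd (negSwapAt ⟨0, by omega⟩ ⟨1, by omega⟩ π) i = desInd π i := fun π i hi => by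
    rw [desInd_negSwapAt_of_ne] <;> simp at hi ⊢ <;> omega
  have h1 := norm_charSum_desPhase_le (χ := negsChar) _ (by simp) (negsChar_flipAt _) hflip θ
  have h2 := norm_charSum_desPhase_le (χ := invChar) _ (by simp)
    (invChar_negSwapAt (by simp)) hswap θ
  have h3 := norm_charSum_desPhase_le (χ := fun π => negsChar π * invChar π) _ (by simp)
    (by simp [negsChar_flipAt, invChar_flipAt]) hflip θ
  have hs : ‖((s : ℤ) : ℂ)‖ = 1 := by
    rcases Int.units_eq_one_or s with h | h <;> simp [h]
  rw [four_mul_sum_filter, add_assoc, add_sub_cancel_left]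
  refine (norm_add_le _ _).trans ?_
  rw [norm_mul, hs, one_mul]
  refine (add_le_add_right (norm_add_le _ _) _).trans ?_
  linarith

end CharacterSums

section Symmetrization

open MeasureTheory Finset

/-- The uniform distribution on `[-1, 1]`. -/
noncomputable def unifSym : Measure ℝ := (2⁻¹ : ENNReal) • volume.restrict (Set.Icc (-1) 1)

instance : IsProbabilityMeasure unifSym := ⟨by
  simp only [unifSym, Measure.smul_apply, Measure.restrict_apply_univ, Real.volume_Icc,
    smul_eq_mul]
  norm_num [ENNReal.inv_mul_cancel]⟩

instance : NullSingletonClass unifSym := ⟨fun x => by simp [unifSym]⟩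

lemma measurePreserving_neg_unifSym : MeasurePreserving (fun x : ℝ => -x) unifSym unifSym := by
  have := (Measure.measurePreserving_neg (volume : Measure ℝ)).restrict_preimage
    (measurableSet_Icc (a := (-1 : ℝ)) (b := 1))
  have h : (Neg.neg ⁻¹' Set.Icc (-1 : ℝ) 1) = Set.Icc (-1) 1 := by ext; simp [and_comm, neg_le]
  rw [h] at this
  exact this.smul_measure _

variable {n : ℕ}

/-- The action of a signed permutation on real vectors by permuting and negating coordinates. -/
def signedAct (g : BG n) (x : Fin n → ℝ) : Fin n → ℝ :=
  fun i => (if g.2 i then -1 else 1) * x (g.1 i)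

lemma measurePreserving_signedAct (g : BG n) :
    MeasurePreserving (signedAct g) (Measure.pi fun _ => unifSym) (Measure.pi fun _ => unifSym) := by
  have h1 : MeasurePreserving (fun x : Fin n → ℝ => fun i => (if g.2 i then -1 else 1) * x i)
      (Measure.pi fun _ => unifSym) (Measure.pi fun _ => unifSym) :=
    measurePreserving_pi (fun _ => unifSym) (fun _ => unifSym)
      (f := fun i y => (if g.2 i then -1 else 1) * y) fun i => by
        cases g.2 i
        · simpa using! MeasurePreserving.id _
        · simpa using measurePreserving_neg_unifSym
  convert h1.comp (measurePreserving_piCongrLeft (fun _ : Fin n => unifSym) g.1.symm) using 1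
  ext x i
  have := MeasurableEquiv.piCongrLeft_apply_apply g.1.symm (β := fun _ => ℝ) x (g.1 i)
  simp only [Equiv.symm_apply_apply] at this
  simp [signedAct, this]

lemma ae_eval_ne_mul_eval {i j : Fin n} (h : i ≠ j) (c : ℝ) :
    ∀ᵐ x : Fin n → ℝ ∂(Measure.pi fun _ => unifSym), x j ≠ c * x i := by
  have hi := (ProbabilityTheory.iIndepFun_pi (μ := fun _ : Fin n => unifSym) (X := fun _ y => y)
    fun _ => aemeasurable_id').indepFun h
  rw [ProbabilityTheory.indepFun_iff_map_prod_eq_prod_map_map (measurable_pi_apply i).aemeasurable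
    (measurable_pi_apply j).aemeasurable] at hi
  have hm : ∀ i, (Measure.pi fun _ : Fin n => unifSym).map (fun x => x i) = unifSym :=
    fun i => (measurePreserving_eval (fun _ : Fin n => unifSym) i).map_eq
  rw [hm, hm] at hi
  have hs : MeasurableSet {p : ℝ × ℝ | p.2 = c * p.1} :=
    measurableSet_eq_fun (by fun_prop) (by fun_prop)
  have h0 : (unifSym.prod unifSym) {p : ℝ × ℝ | p.2 = c * p.1} = 0 := by
    rw [Measure.measure_prod_null hs]
    exact .of_forall fun x => show unifSym {c * x} = 0 from measure_singleton _
  rw [← hi, Measure.map_apply (by fun_prop) hs] at h0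
  exact compl_mem_ae_iff.2 h0

/-- Entry `i` of a real vector with entries numbered from `1`, with `0` as the entry `0`. -/
def vecExt (x : Fin n → ℝ) (i : ℕ) : ℝ :=
  if h : 1 ≤ i ∧ i ≤ n then x ⟨i - 1, by omega⟩ else 0

/-- The number of descents of the sequence `0, x_1, ..., x_n`. -/
noncomputable def vecDes (x : Fin n → ℝ) : ℝ :=
  ∑ i ∈ range n, if vecExt x (i + 1) < vecExt x i then 1 else 0

lemma vecExt_succ (x : Fin n → ℝ) (i : Fin n) : vecExt x (i + 1) = x i := by simp [vecExt]

lemma vecExt_zero (x : Fin n → ℝ) : vecExt x 0 = 0 := by simp [vecExt]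

/-- Left multiplication of signed permutations by the one sorting `x` into an increasing vector
of positive entries. -/
noncomputable def standardize (x : Fin n → ℝ) (g : BG n) : BG n :=
  ((Tuple.sort fun i => |x i|)⁻¹ * g.1, fun i => xor (g.2 i) (decide (x (g.1 i) < 0)))

lemma standardize_bijective (x : Fin n → ℝ) : Function.Bijective (standardize x) := by
  refine Finite.injective_iff_bijective.1 fun g h hgh => ?_
  simp only [standardize, Prod.mk.injEq, mul_right_inj] at hgh
  obtain ⟨h1, h2⟩ := hgh
  rw [h1] at h2
  refine Prod.ext h1 (funext fun i => ?_)
  simpa using congrFun h2 i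

lemma vecDes_signedAct {x : Fin n → ℝ} (h0 : ∀ i, x i ≠ 0)
    (hx : Function.Injective fun i => |x i|) (g : BG n) :
    vecDes (signedAct g x) = desB (standardize x g) := by
  set τ := Tuple.sort fun i => |x i| with hτ
  set y : Fin n → ℝ := fun k => |x (τ k)| with hy
  have hpos : ∀ k, 0 < y k := fun k => abs_pos.2 (h0 _)
  have hmono : StrictMono y := (Tuple.monotone_sort fun i => |x i|).strictMono_of_injective
    (hx.comp τ.injective)
  set π := standardize x g with hπ
  have hact : ∀ i, signedAct g x i = (if π.2 i then -1 else 1) * y (π.1 i) := fun i => by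
    have : τ (π.1 i) = g.1 i := by simp [hπ, standardize, hτ]
    simp only [signedAct, hy, this]
    simp only [hπ, standardize]
    rcases Bool.eq_false_or_eq_true (g.2 i) with h | h <;>
    rcases lt_or_gt_of_ne (h0 (g.1 i)) with h' | h' <;>
    simp [h, h', h'.not_gt, abs_of_neg, abs_of_pos]
  rw [desB_eq_sum]
  refine Finset.sum_congr rfl fun i hi => ?_
  have hi' : i < n := Finset.mem_range.1 hi
  rw [desInd]
  congr 1
  rw [eq_iff_iff, bvalExt_succ π ⟨i, hi'⟩, vecExt_succ _ ⟨i, hi'⟩, hact, bval]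
  rcases i with _ | i
  · rw [vecExt_zero, bvalExt_zero]
    have := hpos (π.1 ⟨0, hi'⟩)
    split_ifs
    · exact iff_of_true (by linarith) (by omega)
    · exact iff_of_false (by linarith) (by omega)
  · have hi2 : i < n := by omega
    rw [bvalExt_succ π ⟨i, hi2⟩, vecExt_succ _ ⟨i, hi2⟩, hact, bval]
    have h1 := hpos (π.1 ⟨i, hi2⟩)
    have h2 := hpos (π.1 ⟨i + 1, hi'⟩)
    have h3 := hmono.lt_iff_lt (a := π.1 ⟨i, hi2⟩) (b := π.1 ⟨i + 1, hi'⟩)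
    have h4 := hmono.lt_iff_lt (b := π.1 ⟨i, hi2⟩) (a := π.1 ⟨i + 1, hi'⟩)
    rw [Fin.lt_def] at h3 h4
    split_ifs
    · rw [show (-1 * y (π.1 ⟨i + 1, hi'⟩) < -1 * y (π.1 ⟨i, hi2⟩)) ↔
        y (π.1 ⟨i, hi2⟩) < y (π.1 ⟨i + 1, hi'⟩) by constructor <;> intro <;> linarith, h3]
      omega
    · exact iff_of_true (by linarith) (by omega)
    · exact iff_of_false (by linarith) (by omega)
    · rw [one_mul, one_mul, h4]
      omega

lemma measurable_vecExt (i : ℕ) : Measurable fun x : Fin n → ℝ => vecExt x i := by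
  unfold vecExt
  split_ifs <;> fun_prop

lemma measurable_vecDes : Measurable (vecDes : (Fin n → ℝ) → ℝ) :=
  Finset.measurable_sum _ fun _ _ => Measurable.ite
    (measurableSet_lt (measurable_vecExt _) (measurable_vecExt _)) measurable_const measurable_const

lemma sum_desB_eq_integral {f : ℝ → ℂ} (hf : Continuous f) {C : ℝ} (hC : ∀ y, ‖f y‖ ≤ C) :
    ∑ π : BG n, f (desB π) = Fintype.card (BG n) *
      ∫ x : Fin n → ℝ, f (vecDes x) ∂(Measure.pi fun _ => unifSym) := by
  have hm : Measurable fun x : Fin n → ℝ => f (vecDes x) := hf.measurable.comp measurable_vecDes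
  have hfi : ∀ g : BG n, Integrable (fun x => f (vecDes (signedAct g x)))
      (Measure.pi fun _ => unifSym) := fun g =>
    .of_bound (hm.comp (measurePreserving_signedAct g).measurable).aestronglyMeasurable C
      (.of_forall fun x => hC _)
  have h1 : ∀ g : BG n, ∫ x, f (vecDes (signedAct g x)) ∂(Measure.pi fun _ => unifSym) =
      ∫ x : Fin n → ℝ, f (vecDes x) ∂(Measure.pi fun _ => unifSym) := fun g => by
    rw [← integral_map (f := fun x => f (vecDes x))
      (measurePreserving_signedAct g).measurable.aemeasurable
      hm.aestronglyMeasurable, (measurePreserving_signedAct g).map_eq]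
  have h2 : ∀ᵐ x : Fin n → ℝ ∂(Measure.pi fun _ => unifSym),
      ∑ g : BG n, f (vecDes (signedAct g x)) = ∑ π : BG n, f (desB π) := by
    have hz : ∀ᵐ x : Fin n → ℝ ∂(Measure.pi fun _ => unifSym), ∀ i, x i ≠ 0 :=
      ae_all_iff.2 fun i => Measure.ae_eval_ne _ i 0
    have hd : ∀ᵐ x : Fin n → ℝ ∂(Measure.pi fun _ => unifSym), ∀ i j, i ≠ j →
        x j ≠ 1 * x i ∧ x j ≠ -1 * x i := ae_all_iff.2 fun i => ae_all_iff.2 fun j => by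
      by_cases h : i = j
      · simp [h]
      · filter_upwards [ae_eval_ne_mul_eval h 1, ae_eval_ne_mul_eval h (-1)] with x h1 h2 _
        exact ⟨h1, h2⟩
    filter_upwards [hz, hd] with x h0 hx
    have hinj : Function.Injective fun i => |x i| := fun i j hij => by
      by_contra h
      rcases abs_eq_abs.1 hij with h' | h'
      · exact (hx i j h).1 (by rw [h', one_mul])
      · exact (hx i j h).2 (by rw [h']; ring)
    simp only [vecDes_signedAct h0 hinj]
    exact (standardize_bijective x).sum_comp fun π => f (desB π)
  calc ∑ π : BG n, f (desB π)
      = ∫ x : Fin n → ℝ, ∑ g : BG n, f (vecDes (signedAct g x)) ∂(Measure.pi fun _ => unifSym) := by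
        rw [integral_congr_ae h2]; simp
    _ = _ := by
        rw [integral_finsetSum _ fun g _ => hfi g]
        simp [h1]

end Symmetrization

section UniformVectors

open MeasureTheory Finset Complex

lemma ae_unifSym_mem_Icc : ∀ᵐ u ∂unifSym, u ∈ Set.Icc (-1 : ℝ) 1 :=
  Measure.ae_smul_measure (ae_restrict_mem measurableSet_Icc) _

lemma integral_unifSym (f : ℝ → ℂ) : ∫ u, f u ∂unifSym = 2⁻¹ * ∫ u in (-1 : ℝ)..1, f u := by
  rw [unifSym, integral_smul_measure, integral_Icc_eq_integral_Ioc,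
    intervalIntegral.integral_of_le (by norm_num), Complex.real_smul]
  simp

lemma integral_unifSym_cyclic_shift {F : ℝ → ℂ} (hF : Continuous F) {l : ℝ}
    (hl : l ∈ Set.Icc (-1 : ℝ) 1) :
    ∫ u, F (u - l + 2 * (if u < l then 1 else 0) - 1) ∂unifSym = ∫ u, F u ∂unifSym := by
  have h1 : ∀ a b, IntervalIntegrable F volume a b := fun a b => hF.intervalIntegrable a b
  have e1 : Set.EqOn (fun u => F (u - l + 2 * (if u < l then 1 else 0) - 1))
      (fun u => F (u + (1 - l))) (Set.uIoo (-1) l) := fun u hu => by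
    rw [Set.uIoo_of_le hl.1] at hu
    simp only [hu.2, if_true]; congr 1; ring
  have e2 : Set.EqOn (fun u => F (u - l + 2 * (if u < l then 1 else 0) - 1))
      (fun u => F (u + (-1 - l))) (Set.uIoo l 1) := fun u hu => by
    rw [Set.uIoo_of_le hl.2] at hu
    simp only [hu.1.not_gt, if_false]; congr 1; ring
  have i1 : IntervalIntegrable (fun u => F (u + (1 - l))) volume (-1) l :=
    (by fun_prop : Continuous fun u => F (u + (1 - l))).intervalIntegrable _ _
  have i2 : IntervalIntegrable (fun u => F (u + (-1 - l))) volume l 1 :=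
    (by fun_prop : Continuous fun u => F (u + (-1 - l))).intervalIntegrable _ _
  rw [integral_unifSym, integral_unifSym,
    ← intervalIntegral.integral_add_adjacent_intervals (i1.congr_uIoo e1.symm)
      (i2.congr_uIoo e2.symm),
    intervalIntegral.integral_congr_uIoo e1, intervalIntegral.integral_congr_uIoo e2,
    intervalIntegral.integral_comp_add_right, intervalIntegral.integral_comp_add_right,
    add_comm, ← intervalIntegral.integral_add_adjacent_intervals (h1 (-1) (-l)) (h1 (-l) 1)]
  congr 3 <;> ring

variable {n : ℕ}

lemma ae_vecExt_mem_Icc (i : ℕ) :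
    ∀ᵐ x : Fin n → ℝ ∂(Measure.pi fun _ => unifSym), vecExt x i ∈ Set.Icc (-1 : ℝ) 1 := by
  unfold vecExt
  split_ifs with h
  · exact (Measure.quasiMeasurePreserving_eval (fun _ => unifSym) _).ae ae_unifSym_mem_Icc
  · simp

lemma vecExt_castSucc (x : Fin (n + 1) → ℝ) {i : ℕ} (hi : i ≤ n) :
    vecExt (fun j : Fin n => x j.castSucc) i = vecExt x i := by
  unfold vecExt
  by_cases h : 1 ≤ i
  · rw [dif_pos ⟨h, hi⟩, dif_pos ⟨h, by omega⟩]; rfl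
  · rw [dif_neg (by omega), dif_neg (by omega)]

lemma vecDes_succ (x : Fin (n + 1) → ℝ) :
    vecDes x = vecDes (fun j : Fin n => x j.castSucc) +
      if x (Fin.last n) < vecExt (fun j : Fin n => x j.castSucc) n then 1 else 0 := by
  rw [vecDes, vecDes, Finset.sum_range_succ, vecExt_castSucc x le_rfl, ← vecExt_succ x (Fin.last n),
    Fin.val_last]
  congr 1
  refine Finset.sum_congr rfl fun i hi => ?_
  have := Finset.mem_range.1 hi
  rw [vecExt_castSucc x (by omega), vecExt_castSucc x (by omega)]

lemma integral_exp_vecDes_add_last (θ : ℝ) (n : ℕ) :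
    ∫ x : Fin n → ℝ, cexp (I * (θ * (vecDes x + vecExt x n / 2 - n / 2) : ℝ))
      ∂(Measure.pi fun _ => unifSym) = charFun unifSym (θ / 2) ^ n := by
  induction n with
  | zero => simp [vecDes, vecExt]
  | succ n ih =>
    set G : ℝ × (Fin n → ℝ) → ℂ := fun p => cexp (I * (θ * (vecDes p.2 +
      (if p.1 < vecExt p.2 n then 1 else 0) + p.1 / 2 - (n + 1) / 2) : ℝ)) with hG
    have hGm : Measurable G := by
      have h1 : Measurable fun p : ℝ × (Fin n → ℝ) => vecDes p.2 :=
        measurable_vecDes.comp measurable_snd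
      have h2 : Measurable fun p : ℝ × (Fin n → ℝ) => if p.1 < vecExt p.2 n then (1 : ℝ) else 0 :=
        Measurable.ite (measurableSet_lt measurable_fst
          ((measurable_vecExt n).comp measurable_snd)) measurable_const measurable_const
      fun_prop
    have hGi : Integrable G (unifSym.prod (Measure.pi fun _ => unifSym)) :=
      .of_bound hGm.aestronglyMeasurable 1 (.of_forall fun p => by
        simp only [hG]
        rw [mul_comm, Complex.norm_exp_ofReal_mul_I])
    have hGe : ∀ x : Fin (n + 1) → ℝ,
        cexp (I * (θ * (vecDes x + vecExt x (n + 1) / 2 - (n + 1 : ℕ) / 2) : ℝ)) =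
          G (MeasurableEquiv.piFinSuccAbove (fun _ => ℝ) (Fin.last n) x) := fun x => by
      have h := vecExt_succ x (Fin.last n)
      rw [Fin.val_last] at h
      have hr : (Fin.last n).removeNth x = fun j => x j.castSucc := by
        funext j; simp [Fin.removeNth]
      rw [h, vecDes_succ]
      simp only [hG, MeasurableEquiv.piFinSuccAbove_apply, Fin.insertNthEquiv_symm_apply, hr]
      push_cast
      rfl
    simp_rw [hGe]
    rw [(measurePreserving_piFinSuccAbove (fun _ => unifSym) (Fin.last n)).integral_comp',
      integral_prod_symm _ hGi, pow_succ, ← ih, ← integral_mul_const]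
    refine integral_congr_ae ?_
    filter_upwards [ae_vecExt_mem_Icc n] with y hy
    have hc := integral_unifSym_cyclic_shift
      (F := fun u => cexp (I * (θ * (vecDes y + vecExt y n / 2 - n / 2) : ℝ)) *
        cexp ((θ / 2 : ℝ) * u * I)) (by fun_prop) hy
    rw [charFun_apply_real, ← integral_const_mul, ← hc]
    refine integral_congr_ae (.of_forall fun u => ?_)
    simp only [hG]
    rw [← Complex.exp_add]
    congr 1
    push_cast
    ring

lemma norm_sum_desPhase_sub_le (θ : ℝ) (n : ℕ) :
    ‖∑ π : BG n, desPhase θ π - Fintype.card (BG n) * charFun unifSym (θ / 2) ^ n‖ ≤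
      1 / 2 * |θ| * Fintype.card (BG n) := by
  have hnorm : ∀ y : ℝ, ‖cexp (I * y)‖ = 1 := fun y => by
    rw [mul_comm, Complex.norm_exp_ofReal_mul_I]
  have h := sum_desB_eq_integral (n := n) (f := fun y => cexp (I * (θ * (y - n / 2) : ℝ)))
    (by fun_prop) (C := 1) (fun y => (hnorm _).le)
  have hi1 : Integrable (fun x : Fin n → ℝ => cexp (I * (θ * (vecDes x - n / 2) : ℝ)))
      (Measure.pi fun _ => unifSym) :=
    .of_bound (by have := measurable_vecDes (n := n); fun_prop) 1 (.of_forall fun x => (hnorm _).le)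
  have hi2 : Integrable
      (fun x : Fin n → ℝ => cexp (I * (θ * (vecDes x + vecExt x n / 2 - n / 2) : ℝ)))
      (Measure.pi fun _ => unifSym) :=
    .of_bound (by
      have := measurable_vecDes (n := n)
      have := measurable_vecExt (n := n) n
      fun_prop) 1 (.of_forall fun x => (hnorm _).le)
  simp only [desPhase]
  rw [h, ← integral_exp_vecDes_add_last, ← mul_sub, norm_mul, ← integral_sub hi1 hi2,
    Complex.norm_natCast, mul_comm]
  gcongr
  refine (norm_integral_le_of_norm_le_const (C := 1 / 2 * |θ|) ?_).trans (by simp)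
  filter_upwards [ae_vecExt_mem_Icc n] with x hx
  refine (norm_exp_I_mul_sub_le _ _).trans ?_
  rw [← mul_sub, abs_mul, mul_comm]
  gcongr
  rw [abs_le]
  constructor <;> linarith [hx.1, hx.2]

end UniformVectors

section CharacteristicFunctionLimit

open MeasureTheory Filter Topology Finset Complex

lemma tendsto_div_sqrt (t : ℝ) :
    Tendsto (fun n : ℕ => t / √(((n : ℝ) + 1) / 12)) atTop (𝓝 0) :=
  tendsto_const_nhds.div_atTop (Real.tendsto_sqrt_atTop.comp
    ((tendsto_atTop_add_const_right _ _ tendsto_natCast_atTop_atTop).atTop_div_const (by norm_num)))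

lemma tendsto_charFun_unifSym_pow (t : ℝ) :
    Tendsto (fun n : ℕ => charFun unifSym (t / √(((n : ℝ) + 1) / 12) / 2) ^ n) atTop
      (𝓝 (cexp (-t ^ 2 / 2))) := by
  have hm : ∫ u, √3 * u ∂unifSym = 0 := by
    rw [integral_const_mul, unifSym, integral_smul_measure, integral_Icc_eq_integral_Ioc,
      ← intervalIntegral.integral_of_le (by norm_num)]
    simp
  have hv : ∫ u, ((fun u : ℝ => √3 * u) ^ 2) u ∂unifSym = 1 := by
    simp only [Pi.pow_apply, mul_pow]
    rw [integral_const_mul, unifSym, integral_smul_measure, integral_Icc_eq_integral_Ioc,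
      ← intervalIntegral.integral_of_le (by norm_num)]
    norm_num [integral_pow]
  have hlim := (ProbabilityTheory.tendsto_charFun_inv_sqrt_mul_pow
    (by fun_prop : AEMeasurable (fun u : ℝ => √3 * u) unifSym) hm hv t).comp (tendsto_add_atTop_nat 1)
  have hs : ∀ n : ℕ, √3 * ((√((n + 1 : ℕ) : ℝ))⁻¹ * t) = t / √(((n : ℝ) + 1) / 12) / 2 := fun n => by
    have h12 : √(12 : ℝ) = 2 * √3 := by
      rw [show (12 : ℝ) = 2 ^ 2 * 3 by norm_num, Real.sqrt_mul (by norm_num),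
        Real.sqrt_sq (by norm_num)]
    have hpos : √((n : ℝ) + 1) ≠ 0 := by positivity
    rw [Real.sqrt_div (by positivity), h12]
    push_cast
    field_simp
  have hlim' : Tendsto (fun n : ℕ => charFun unifSym (t / √(((n : ℝ) + 1) / 12) / 2) ^ (n + 1)) atTop
      (𝓝 (cexp (-t ^ 2 / 2))) := by
    refine hlim.congr fun n => ?_
    simp only [Function.comp_apply]
    rw [charFun_map_mul, hs]
  have hθ : Tendsto (fun n : ℕ => t / √(((n : ℝ) + 1) / 12) / 2) atTop (𝓝 0) := by
    simpa only [zero_div] using (tendsto_div_sqrt t).div_const 2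
  have h1 : Tendsto (fun n : ℕ => charFun unifSym (t / √(((n : ℝ) + 1) / 12) / 2)) atTop (𝓝 1) := by
    have := (continuous_charFun (μ := unifSym)).tendsto 0
    rw [charFun_zero] at this
    simpa only [probReal_univ, Complex.ofReal_one] using! this.comp hθ
  have h2 := hlim'.div h1 one_ne_zero
  rw [div_one] at h2
  refine h2.congr' ?_
  filter_upwards [h1.eventually_ne one_ne_zero] with n hn
  rw [Pi.div_apply, pow_succ, mul_div_cancel_right₀ _ hn]

lemma tendsto_mean_desPhase (s : ℤˣ) (t : ℝ) :
    Tendsto (fun n : ℕ => (∑ π : BG n with negsChar π = 1 ∧ invChar π = s,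
        desPhase (t / √(((n : ℝ) + 1) / 12)) π) / ((Fintype.card (BG n) : ℂ) / 4)) atTop
      (𝓝 (cexp (-t ^ 2 / 2))) := by
  refine (tendsto_charFun_unifSym_pow t).congr_dist ?_
  have h0 := ((tendsto_div_sqrt t).abs).const_mul 5
  rw [abs_zero, mul_zero] at h0
  refine squeeze_zero' (.of_forall fun _ => dist_nonneg) ?_ h0
  filter_upwards [eventually_ge_atTop 2] with n hn
  set θ := t / √(((n : ℝ) + 1) / 12)
  have hc : (0 : ℝ) < Fintype.card (BG n) := by exact_mod_cast Fintype.card_pos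
  have hc' : (Fintype.card (BG n) : ℂ) ≠ 0 := by exact_mod_cast hc.ne'
  have h1 := norm_four_mul_sum_filter_desPhase_sub_le hn s θ
  have h2 := norm_sum_desPhase_sub_le θ n
  rw [dist_comm, dist_eq_norm]
  refine le_of_mul_le_mul_right ?_ hc
  rw [← Complex.norm_natCast, ← norm_mul, Complex.norm_natCast]
  have h3 : ((∑ π : BG n with negsChar π = 1 ∧ invChar π = s, desPhase θ π) /
      ((Fintype.card (BG n) : ℂ) / 4) - charFun unifSym (θ / 2) ^ n) * Fintype.card (BG n) =
      (4 * ∑ π : BG n with negsChar π = 1 ∧ invChar π = s, desPhase θ π - ∑ π : BG n, desPhase θ π) +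
      (∑ π : BG n, desPhase θ π - Fintype.card (BG n) * charFun unifSym (θ / 2) ^ n) := by
    field_simp
    ring
  rw [h3]
  refine (norm_add_le _ _).trans ?_
  linarith

end CharacteristicFunctionLimit

section UniformConvergence

open Filter Topology

/-- **Pólya's theorem**: pointwise convergence of distribution functions to a continuous
distribution function is uniform. -/
lemma tendsto_iSup_abs_sub_of_monotone {F : ℕ → ℝ → ℝ} {G : ℝ → ℝ}
    (hF : ∀ᶠ n in atTop, Monotone (F n) ∧ ∀ x, F n x ∈ Set.Icc (0 : ℝ) 1) (hG : Monotone G)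
    (hGc : Continuous G) (hG0 : Tendsto G atBot (𝓝 0)) (hG1 : Tendsto G atTop (𝓝 1))
    (h : ∀ x, Tendsto (fun n => F n x) atTop (𝓝 (G x))) :
    Tendsto (fun n => ⨆ x, |F n x - G x|) atTop (𝓝 0) := by
  have hG0' : ∀ x, 0 ≤ G x := hG.le_of_tendsto hG0
  have hG1' : ∀ x, G x ≤ 1 := hG.ge_of_tendsto hG1
  rw [Metric.tendsto_atTop']
  suffices H : ∀ ε > 0, ∀ᶠ n in atTop, (⨆ x, |F n x - G x|) < ε by
    intro ε hε
    obtain ⟨N, hN⟩ := eventually_atTop.1 (H ε hε)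
    refine ⟨N, fun n hn => ?_⟩
    rw [Real.dist_0_eq_abs, abs_of_nonneg (Real.iSup_nonneg fun x => abs_nonneg _)]
    exact hN n hn.le
  intro ε hε
  obtain ⟨K, hK⟩ := exists_nat_gt (3 / ε)
  have hK0 : (0 : ℝ) < K := lt_trans (by positivity) hK
  have hsurj : ∀ j : ℕ, ∃ q, 1 ≤ j → j < K → G q = j / K := fun j => by
    by_cases hj : 1 ≤ j ∧ j < K
    · have hj1 : (1 : ℝ) ≤ j := by exact_mod_cast hj.1
      have hjK : (j : ℝ) < K := by exact_mod_cast hj.2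
      have h1 : (0 : ℝ) < j / K := by positivity
      have h2 : (j : ℝ) / K < 1 := (div_lt_one hK0).2 hjK
      obtain ⟨q, hq⟩ := mem_range_of_exists_le_of_exists_ge hGc
        ((hG0.eventually_le_const h1).exists) ((hG1.eventually_const_le h2).exists)
      exact ⟨q, fun _ _ => hq⟩
    · exact ⟨0, fun h1 h2 => absurd ⟨h1, h2⟩ hj⟩
  choose q hq using hsurj
  have hev : ∀ᶠ n in atTop, ∀ j ∈ Finset.range K, |F n (q j) - G (q j)| < 1 / K :=
    (eventually_all_finset _).2 fun j _ => by
      simpa only [Real.dist_eq] using (Metric.tendsto_nhds.1 (h (q j))) (1 / K) (by positivity)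
  filter_upwards [hF, hev] with n ⟨hmono, hmem⟩ hn
  have hbound : ∀ x, |F n x - G x| ≤ 3 / K := fun x => by
    set j := ⌊K * G x⌋₊ with hj
    have hj1 : (j : ℝ) ≤ K * G x := Nat.floor_le (mul_nonneg hK0.le (hG0' x))
    have hj2 : K * G x < j + 1 := Nat.lt_floor_add_one _
    have hle : (j : ℝ) / K ≤ G x := by rwa [div_le_iff₀' hK0]
    have hlt : G x < (j + 1) / K := by rwa [lt_div_iff₀' hK0]
    have e1 : ((j : ℝ) + 1) / K = j / K + 1 / K := by ring
    have e3 : (3 : ℝ) / K = 1 / K + 1 / K + 1 / K := by ring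
    have hKpos : (0 : ℝ) < 1 / K := by positivity
    rw [abs_le]
    constructor
    · by_cases hj' : 2 ≤ j
      · have hjK : j - 1 < K := by
          have : (j : ℝ) ≤ K := hj1.trans (mul_le_of_le_one_right hK0.le (hG1' x))
          have : j ≤ K := by exact_mod_cast this
          omega
        have hqj := hq (j - 1) (by omega) hjK
        have e2 : ((j - 1 : ℕ) : ℝ) / K = j / K - 1 / K := by
          rw [Nat.cast_sub (by omega)]; push_cast; ring
        have hx : q (j - 1) ≤ x := (hG.reflect_lt (by linarith)).le
        have := (abs_lt.1 (hn (j - 1) (Finset.mem_range.2 hjK))).1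
        linarith [hmono hx]
      · have : (j : ℝ) ≤ 1 := by exact_mod_cast (by omega : j ≤ 1)
        have : (j : ℝ) / K ≤ 1 / K := by gcongr
        linarith [(hmem x).1]
    · by_cases hj' : j + 1 < K
      · have hqj := hq (j + 1) (by omega) hj'
        push_cast at hqj
        have hx : x ≤ q (j + 1) := (hG.reflect_lt (by linarith)).le
        have := (abs_lt.1 (hn (j + 1) (Finset.mem_range.2 hj'))).2
        linarith [hmono hx]
      · have : (K : ℝ) ≤ j + 1 := by exact_mod_cast (by omega : K ≤ j + 1)
        have : 1 ≤ ((j : ℝ) + 1) / K := by rwa [le_div_iff₀ hK0, one_mul]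
        linarith [(hmem x).2]
  refine (ciSup_le hbound).trans_lt ?_
  rwa [div_lt_iff₀ hK0, mul_comm, ← div_lt_iff₀ hε]

end UniformConvergence

section EmpiricalMeasure

open MeasureTheory Finset Complex ProbabilityTheory

variable {α : Type*}

/-- The uniform distribution on the values of `y` on the finite set `s`. -/
noncomputable def empiricalMeasure (s : Finset α) (y : α → ℝ) : Measure ℝ :=
  (#s : ENNReal)⁻¹ • ∑ a ∈ s, Measure.dirac (y a)

lemma isProbabilityMeasure_empiricalMeasure {s : Finset α} (hs : s.Nonempty) (y : α → ℝ) :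
    IsProbabilityMeasure (empiricalMeasure s y) := ⟨by
  simpa [empiricalMeasure, Measure.finsetSum_apply] using
    ENNReal.inv_mul_cancel (a := (#s : ENNReal)) (by simp [hs.ne_empty]) (by simp)⟩

lemma charFun_empiricalMeasure (s : Finset α) (y : α → ℝ) (t : ℝ) :
    charFun (empiricalMeasure s y) t = (∑ a ∈ s, cexp (I * (t * y a : ℝ))) / #s := by
  rw [charFun_apply_real, empiricalMeasure, integral_smul_measure,
    integral_finsetSum_measure fun _ _ => integrable_dirac (by simp), div_eq_inv_mul,
    Complex.real_smul]
  simp [mul_comm I]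

lemma empiricalMeasure_real_Iic (s : Finset α) (y : α → ℝ) (x : ℝ) :
    (empiricalMeasure s y).real (Set.Iic x) = (∑ a ∈ s, if y a ≤ x then (1 : ℝ) else 0) / #s := by
  simp [empiricalMeasure, Measure.real, Measure.finsetSum_apply, Set.indicator_apply,
    div_eq_inv_mul]

lemma stdNormalCDF_eq_cdf : stdNormalCDF = cdf (gaussianReal 0 1) := by
  funext x
  rw [cdf_eq_real, Measure.real, gaussianReal_apply_eq_integral _ one_ne_zero,
    ENNReal.toReal_ofReal (integral_nonneg fun _ => gaussianPDFReal_nonneg _ _ _), stdNormalCDF]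
  refine integral_congr_ae (.of_forall fun t => ?_)
  simp [gaussianPDFReal_def, div_eq_inv_mul]

lemma continuous_stdNormalCDF : Continuous stdNormalCDF := by
  have := nullSingletonClass_gaussianReal (μ := 0) one_ne_zero
  rw [stdNormalCDF_eq_cdf, continuous_iff_continuousAt]
  intro x
  have h := (cdf (gaussianReal 0 1)).measure_singleton x
  rw [measure_cdf, measure_singleton, eq_comm, ENNReal.ofReal_eq_zero, sub_nonpos] at h
  rw [(monotone_cdf _).continuousAt_iff_leftLim_eq_rightLim, StieltjesFunction.rightLim_eq]
  exact le_antisymm ((monotone_cdf _).leftLim_le le_rfl) h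

end EmpiricalMeasure

section AsymptoticNormality

open MeasureTheory ProbabilityTheory Filter Topology Finset Complex

lemma card_filter_negsChar_invChar {n : ℕ} (hn : 2 ≤ n) (s : ℤˣ) :
    (#{π : BG n | negsChar π = 1 ∧ invChar π = s} : ℝ) = Fintype.card (BG n) / 4 := by
  rw [← sum_filter_one hn s, Finset.sum_const, nsmul_eq_mul, mul_one]

lemma filter_negsChar_invChar_nonempty {n : ℕ} (hn : 2 ≤ n) (s : ℤˣ) :
    ({π : BG n | negsChar π = 1 ∧ invChar π = s} : Finset (BG n)).Nonempty := by
  rw [← Finset.card_pos, ← Nat.cast_pos (α := ℝ), card_filter_negsChar_invChar hn]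
  have : 0 < Fintype.card (BG n) := Fintype.card_pos
  positivity

lemma tendsto_rowCDF_desCount (s : ℤˣ) (x : ℝ) :
    Tendsto (fun n : ℕ => rowCDF (desCount s) n
      (x * √(rowVar (desCount s) n) + rowMean (desCount s) n)) atTop (𝓝 (stdNormalCDF x)) := by
  set D : (n : ℕ) → Finset (BG n) := fun n => {π | negsChar π = 1 ∧ invChar π = s} with hD
  set y : (n : ℕ) → BG n → ℝ := fun n π => (desB π - n / 2) / √(((n : ℝ) + 1) / 12) with hy
  have hP : ∀ n, IsProbabilityMeasure (empiricalMeasure (D (n + 2)) (y (n + 2))) := fun n =>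
    isProbabilityMeasure_empiricalMeasure (filter_negsChar_invChar_nonempty (by omega) s) _
  have hlaw : Tendsto (β := ProbabilityMeasure ℝ) (fun n => ⟨_, hP n⟩) atTop
      (𝓝 (⟨gaussianReal 0 1, inferInstance⟩ : ProbabilityMeasure ℝ)) := by
    refine ProbabilityMeasure.tendsto_iff_tendsto_charFun.2 fun t => ?_
    have h := (tendsto_mean_desPhase s t).comp (tendsto_add_atTop_nat 2)
    have hg : charFun (gaussianReal 0 1) t = cexp (-t ^ 2 / 2) := by
      rw [charFun_gaussianReal]; congr 1; push_cast; ring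
    simp only [ProbabilityMeasure.coe_mk, hg]
    refine h.congr fun n => ?_
    have hc := card_filter_negsChar_invChar (n := n + 2) (by omega) s
    rw [charFun_empiricalMeasure, Function.comp_apply]
    congr 1
    · refine Finset.sum_congr rfl fun π _ => ?_
      simp only [desPhase, hy]
      congr 3
      ring
    · have := congrArg Complex.ofReal hc
      push_cast at this
      exact this.symm
  have := nullSingletonClass_gaussianReal (μ := 0) one_ne_zero
  have hcdf := ProbabilityMeasure.tendsto_measure_of_null_frontier_of_tendsto' hlaw
    (E := Set.Iic x) (by rw [frontier_Iic]; exact measure_singleton (μ := gaussianReal 0 1) x)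
  have hreal := (ENNReal.tendsto_toReal (measure_ne_top (gaussianReal 0 1) _)).comp hcdf
  rw [← tendsto_add_atTop_iff_nat 2, stdNormalCDF_eq_cdf, cdf_eq_real]
  refine hreal.congr' ?_
  filter_upwards [eventually_ge_atTop 2] with n hn
  have hσ : 0 < √(((n + 2 : ℕ) + 1 : ℝ) / 12) := by positivity
  rw [rowVar_desCount (by omega), rowMean_desCount (by omega), rowCDF_desCount (by omega),
    ← card_filter_negsChar_invChar (by omega) s]
  refine (empiricalMeasure_real_Iic _ _ x).trans ?_
  congr 1
  refine Finset.sum_congr rfl fun π _ => ?_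
  simp only [hy, div_le_iff₀ hσ, sub_le_iff_le_add]

lemma rowCDF_desCount_mem_Icc {n : ℕ} (hn : 2 ≤ n) (s : ℤˣ) (y : ℝ) :
    rowCDF (desCount s) n y ∈ Set.Icc (0 : ℝ) 1 := by
  rw [rowCDF_desCount hn, ← card_filter_negsChar_invChar hn s]
  refine ⟨by positivity, div_le_one_of_le₀ ?_ (by positivity)⟩
  rw [Finset.sum_boole]
  exact_mod_cast Finset.card_filter_le _ _

lemma monotone_rowCDF_desCount {n : ℕ} (hn : 2 ≤ n) (s : ℤˣ) :
    Monotone (rowCDF (desCount s) n) := fun a b hab => by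
  rw [rowCDF_desCount hn, rowCDF_desCount hn]
  gcongr with π
  split_ifs with h1 h2 <;> first | exact absurd (h1.trans hab) h2 | norm_num

lemma isAsympNormal_desCount (s : ℤˣ) : IsAsympNormal (desCount s) := by
  have hG := stdNormalCDF_eq_cdf
  refine tendsto_iSup_abs_sub_of_monotone ?_ (hG ▸ monotone_cdf _) continuous_stdNormalCDF
    (hG ▸ tendsto_cdf_atBot _) (hG ▸ tendsto_cdf_atTop _) (tendsto_rowCDF_desCount s)
  filter_upwards [eventually_ge_atTop 2] with n hn
  refine ⟨fun a b hab => monotone_rowCDF_desCount hn s ?_,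
    fun x => rowCDF_desCount_mem_Icc hn s _⟩
  gcongr

end AsymptoticNormality

/-- Theorem: the coefficients of `BDes_n^{D,±}(t)` are asymptotically normal; for `n ≥ 3`
the mean is `n/2` and for `n ≥ 4` the variance is `(n+1)/12`. -/
theorem typeD_clt_bdes_plus_minus :
    IsAsympNormal cBDesDP ∧ IsAsympNormal cBDesDM ∧
    (∀ n : ℕ, 3 ≤ n → rowMean cBDesDP n = (n : ℝ) / 2 ∧ rowMean cBDesDM n = (n : ℝ) / 2) ∧
    (∀ n : ℕ, 4 ≤ n →
      rowVar cBDesDP n = ((n : ℝ) + 1) / 12 ∧ rowVar cBDesDM n = ((n : ℝ) + 1) / 12) := by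
  rw [cBDesDP_eq, cBDesDM_eq]
  exact ⟨isAsympNormal_desCount 1, isAsympNormal_desCount (-1),
    fun n hn => ⟨rowMean_desCount hn 1, rowMean_desCount hn (-1)⟩,
    fun n hn => ⟨rowVar_desCount hn 1, rowVar_desCount hn (-1)⟩⟩
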